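/- For every starting point x ∈ ℤ, P_x-almost surely, lim_{j→∞} β_j / j = 2. -/

import Mathlib

open MeasureTheory Filter ProbabilityTheory

noncomputable section

/-- One-step transition probability of the urn discrepancy chain with parameter `lam`:
from state `i`, jump to `i+1` with probability `lam^(2i-1)/(1+lam^(2i-1))` and to `i-1`
with probability `1/(1+lam^(2i-1))`. -/
def urnStep (lam : ℝ) (i j : ℤ) : ℝ :=
  if j = i + 1 then lam ^ (2 * i - 1) / (1 + lam ^ (2 * i - 1))
  else if j = i - 1 then 1 / (1 + lam ^ (2 * i - 1))
  else 0

/-- `P` is the family of laws (indexed by the starting point) of the urn discrepancy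
chain with parameter `lam`, characterized by its cylinder probabilities. -/
def IsUrnChain (lam : ℝ) (P : ℤ → Measure (ℕ → ℤ)) : Prop :=
  (∀ x, IsProbabilityMeasure (P x)) ∧
    ∀ (x : ℤ) (n : ℕ) (p : ℕ → ℤ),
      (P x {ω | ∀ i ≤ n, ω i = p i}).toReal =
        (if p 0 = x then (1 : ℝ) else 0) *
          ∏ i ∈ Finset.range n, urnStep lam (p i) (p (i + 1))

/-- Number of down-steps of the path `ω` during the time interval `[1, j]`. -/
def downCount (ω : ℕ → ℤ) (j : ℕ) : ℕ :=
  ((Finset.Icc 1 j).filter fun ℓ => ω ℓ = ω (ℓ - 1) - 1).card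

/-- `betaTime ω i` is the time of the `i`-th down-step of the path `ω`. -/
def betaTime (ω : ℕ → ℤ) (i : ℕ) : ℕ :=
  sInf {j | 1 ≤ j ∧ downCount ω j = i}

/-- The probability distribution `π(x) = lam^(x²) / Σ_y lam^(y²)` on `ℤ`. -/
def urnPi (lam : ℝ) (x : ℤ) : ℝ :=
  lam ^ (x ^ 2) / ∑' y : ℤ, lam ^ (y ^ 2)

/-- An unnormalised reversible measure of the urn discrepancy chain. -/
def urnWeight (lam : ℝ) (i : ℤ) : ℝ :=
  lam ^ (i ^ 2 - 2 * i) + lam ^ (i ^ 2 - 1)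

theorem urnWeight_pos {lam : ℝ} (h0 : 0 < lam) (i : ℤ) : 0 < urnWeight lam i := by
  unfold urnWeight; positivity

theorem urnStep_nonneg {lam : ℝ} (h0 : 0 < lam) (i j : ℤ) : 0 ≤ urnStep lam i j := by
  unfold urnStep; split_ifs <;> positivity

theorem urnWeight_eq_mul {lam : ℝ} (h0 : 0 < lam) (i : ℤ) :
    urnWeight lam i = lam ^ (i ^ 2 - 2 * i) * (1 + lam ^ (2 * i - 1)) := by
  unfold urnWeight
  rw [mul_add, mul_one, ← zpow_add₀ h0.ne']
  congr 2; ring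

theorem urnWeight_mul_urnStep_up {lam : ℝ} (h0 : 0 < lam) (y : ℤ) :
    urnWeight lam (y - 1) * urnStep lam (y - 1) y = lam ^ (y ^ 2 - 2 * y) := by
  have hpos : 0 < 1 + lam ^ (2 * (y - 1) - 1) := by positivity
  rw [urnWeight_eq_mul h0, urnStep, if_pos (by ring), mul_assoc, mul_div_cancel₀ _ hpos.ne',
    ← zpow_add₀ h0.ne']
  congr 1; ring

theorem urnWeight_mul_urnStep_down {lam : ℝ} (h0 : 0 < lam) (y : ℤ) :
    urnWeight lam (y + 1) * urnStep lam (y + 1) y = lam ^ (y ^ 2 - 1) := by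
  have hpos : 0 < 1 + lam ^ (2 * (y + 1) - 1) := by positivity
  rw [urnWeight_eq_mul h0, urnStep, if_neg (by omega), if_pos (by ring), mul_assoc,
    mul_div_cancel₀ _ hpos.ne', mul_one]
  congr 1; ring

theorem summable_sq_mul_urnWeight {lam : ℝ} (hlam : lam ∈ Set.Ioo (0 : ℝ) 1) :
    Summable fun y : ℤ => (y : ℝ) ^ 2 * urnWeight lam y := by
  obtain ⟨h0, h1⟩ := hlam
  have hs : Summable fun n : ℕ => (n : ℝ) ^ 2 * lam ^ n :=
    summable_pow_mul_geometric_of_norm_lt_one 2 (by rwa [Real.norm_of_nonneg h0.le])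
  have hz : Summable fun y : ℤ => (y : ℝ) ^ 2 * lam ^ |y| := by
    refine Summable.of_nat_of_neg ?_ ?_ <;> simpa using hs
  refine Summable.of_nonneg_of_le
    (fun y => mul_nonneg (sq_nonneg _) (urnWeight_pos h0 y).le) (fun y => ?_)
    (hz.mul_left (2 * lam ^ (-3 : ℤ)))
  have hsq : 0 ≤ (y : ℝ) ^ 2 := sq_nonneg _
  have hle : ∀ m : ℤ, |y| - 3 ≤ m → lam ^ m ≤ lam ^ (-3 : ℤ) * lam ^ |y| := by
    intro m hm
    rw [← zpow_add₀ h0.ne']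
    exact zpow_le_zpow_right_of_le_one₀ h0 h1.le (by omega)
  have e1 := hle (y ^ 2 - 2 * y) (by
    rcases abs_cases y with ⟨h, _⟩ | ⟨h, _⟩ <;> rw [h] <;> nlinarith [sq_nonneg (2 * y - 3)])
  have e2 := hle (y ^ 2 - 1) (by
    rcases abs_cases y with ⟨h, _⟩ | ⟨h, _⟩ <;> rw [h] <;> nlinarith)
  calc (y : ℝ) ^ 2 * urnWeight lam y
      ≤ (y : ℝ) ^ 2 * (lam ^ (-3 : ℤ) * lam ^ |y| + lam ^ (-3 : ℤ) * lam ^ |y|) :=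
        mul_le_mul_of_nonneg_left (add_le_add e1 e2) hsq
    _ = 2 * lam ^ (-3 : ℤ) * ((y : ℝ) ^ 2 * lam ^ |y|) := by ring

section Chain

variable {lam : ℝ} {P : ℤ → Measure (ℕ → ℤ)}

theorem IsUrnChain.measure_cylinder_succ (hP : IsUrnChain lam P) (x : ℤ) (n : ℕ)
    (p : ℕ → ℤ) :
    P x {ω | ∀ i ≤ n + 1, ω i = p i} =
      P x {ω | ∀ i ≤ n, ω i = p i} * ENNReal.ofReal (urnStep lam (p n) (p (n + 1))) := by
  have := hP.1 x
  rw [← ENNReal.ofReal_toReal (measure_ne_top (P x) {ω | ∀ i ≤ n + 1, ω i = p i}),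
    ← ENNReal.ofReal_toReal (measure_ne_top (P x) {ω | ∀ i ≤ n, ω i = p i}),
    ← ENNReal.ofReal_mul ENNReal.toReal_nonneg, hP.2, hP.2, Finset.prod_range_succ, mul_assoc]

theorem IsUrnChain.measure_step (hP : IsUrnChain lam P) (x : ℤ) (n : ℕ)
    (z y : ℤ) :
    P x {ω | ω n = z ∧ ω (n + 1) = y} =
      P x {ω | ω n = z} * ENNReal.ofReal (urnStep lam z y) := by
  let f : (ℕ → ℤ) → (Fin (n + 1) → ℤ) := fun ω i => ω i
  have hf : Measurable f := by fun_prop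
  let S : Set (Fin (n + 1) → ℤ) := {q | q (Fin.last n) = z}
  have hS : f ⁻¹' S = {ω | ω n = z} := by ext ω; simp [f, S]
  have hy : MeasurableSet {ω : ℕ → ℤ | ω (n + 1) = y} :=
    (measurable_pi_apply (X := fun _ : ℕ => ℤ) (n + 1)) (measurableSet_singleton y)
  have key (μ : Measure (ℕ → ℤ)) : μ {ω | ω n = z} = ∑' q : S, μ (f ⁻¹' {q.1}) := by
    rw [← hS]
    exact (tsum_measure_preimage_singleton S.to_countable
      fun q _ => hf (measurableSet_singleton q)).symm
  have hL : P x {ω | ω n = z ∧ ω (n + 1) = y} =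
      (P x).restrict {ω | ω (n + 1) = y} {ω | ω n = z} := by
    rw [Measure.restrict_apply' hy]; rfl
  rw [hL, key, key, ← ENNReal.tsum_mul_right]
  congr 1 with ⟨q, hq⟩
  rw [Measure.restrict_apply' hy]
  let p : ℕ → ℤ := fun i => if h : i < n + 1 then q ⟨i, h⟩ else y
  have hp : ∀ i (h : i < n + 1), p i = q ⟨i, h⟩ := fun i h => dif_pos h
  have hpn : p n = z := (hp n (Nat.lt_succ_self n)).trans hq
  have hpn1 : p (n + 1) = y := dif_neg (lt_irrefl _)
  have hcyl : f ⁻¹' {q} = {ω | ∀ i ≤ n, ω i = p i} := by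
    ext ω
    simp only [Set.mem_preimage, Set.mem_singleton_iff, Set.mem_ofPred_eq, funext_iff, f]
    constructor
    · intro h i hi
      rw [hp i (by omega)]; exact h ⟨i, by omega⟩
    · intro h i
      rw [h i (by omega), hp i i.2]
  have hcyl' : f ⁻¹' {q} ∩ {ω | ω (n + 1) = y} = {ω | ∀ i ≤ n + 1, ω i = p i} := by
    rw [hcyl]
    ext ω
    simp only [Set.mem_inter_iff, Set.mem_ofPred_eq]
    constructor
    · rintro ⟨h, h'⟩ i hi
      rcases Nat.le_succ_iff.mp hi with hi | rfl
      · exact h i hi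
      · rw [h', hpn1]
    · intro h
      exact ⟨fun i hi => h i (by omega), by rw [h (n + 1) le_rfl, hpn1]⟩
  rw [hcyl', hP.measure_cylinder_succ, hcyl, hpn, hpn1]

theorem IsUrnChain.ae_nearest_neighbor (hP : IsUrnChain lam P) (x : ℤ) :
    ∀ᵐ ω ∂(P x), ∀ n, ω (n + 1) = ω n + 1 ∨ ω (n + 1) = ω n - 1 := by
  have h : ∀ᵐ ω ∂(P x), ∀ (n : ℕ) (z y : ℤ), ¬(y = z + 1 ∨ y = z - 1) →
      ¬(ω n = z ∧ ω (n + 1) = y) := by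
    simp only [ae_all_iff]
    intro n z y hzy
    rw [ae_iff]
    push Not at hzy ⊢
    rw [hP.measure_step, urnStep, if_neg hzy.1, if_neg hzy.2]
    simp
  filter_upwards [h] with ω hω n
  by_contra hn
  exact hω n (ω n) (ω (n + 1)) hn ⟨rfl, rfl⟩

theorem IsUrnChain.measure_le_urnWeight (h0 : 0 < lam) (hP : IsUrnChain lam P) (x : ℤ) (n : ℕ)
    (y : ℤ) :
    P x {ω | ω n = y} ≤ ENNReal.ofReal (urnWeight lam y / urnWeight lam x) := by
  have hx := urnWeight_pos h0 x
  have := hP.1 x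
  induction n generalizing y with
  | zero =>
    by_cases hxy : y = x
    · subst hxy
      rw [div_self hx.ne', ENNReal.ofReal_one]
      exact prob_le_one
    · have h := hP.2 x 0 (fun _ => y)
      simp only [nonpos_iff_eq_zero, forall_eq, if_neg hxy, zero_mul] at h
      rw [ENNReal.toReal_eq_zero_iff] at h
      rw [h.resolve_right (measure_ne_top _ _)]
      exact zero_le
  | succ n ih =>
    have hle : P x {ω | ω (n + 1) = y} ≤
        P x ({ω | ω n = y - 1 ∧ ω (n + 1) = y} ∪ {ω | ω n = y + 1 ∧ ω (n + 1) = y}) := by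
      refine measure_mono_ae ?_
      filter_upwards [hP.ae_nearest_neighbor x] with ω hω hy
      have hy : ω (n + 1) = y := hy
      rcases hω n with h | h
      · exact Or.inl ⟨by omega, hy⟩
      · exact Or.inr ⟨by omega, hy⟩
    refine hle.trans ((measure_union_le _ _).trans ?_)
    rw [hP.measure_step, hP.measure_step]
    refine (add_le_add (mul_le_mul_left (ih _) _) (mul_le_mul_left (ih _) _)).trans ?_
    have hw : ∀ z, 0 ≤ urnWeight lam z / urnWeight lam x := fun z =>
      div_nonneg (urnWeight_pos h0 z).le hx.le
    rw [← ENNReal.ofReal_mul (hw _), ← ENNReal.ofReal_mul (hw _),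
      ← ENNReal.ofReal_add (mul_nonneg (hw _) (urnStep_nonneg h0 _ _))
        (mul_nonneg (hw _) (urnStep_nonneg h0 _ _)),
      div_mul_eq_mul_div, div_mul_eq_mul_div, urnWeight_mul_urnStep_up h0,
      urnWeight_mul_urnStep_down h0, ← add_div]
    rfl

theorem IsUrnChain.lintegral_sq_le (h0 : 0 < lam) (hP : IsUrnChain lam P) (x : ℤ) (n : ℕ) :
    ∫⁻ ω, ENNReal.ofReal ((ω n : ℝ) ^ 2) ∂(P x) ≤
      ∑' y : ℤ, ENNReal.ofReal ((y : ℝ) ^ 2 * urnWeight lam y / urnWeight lam x) := by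
  have hn : Measurable fun ω : ℕ → ℤ => ω n := measurable_pi_apply n
  rw [← lintegral_map (f := fun y : ℤ => ENNReal.ofReal ((y : ℝ) ^ 2))
    (Measurable.of_discrete) hn, lintegral_countable']
  refine ENNReal.tsum_le_tsum fun y => ?_
  rw [Measure.map_apply hn (measurableSet_singleton y), mul_div_assoc,
    ENNReal.ofReal_mul (sq_nonneg _)]
  exact mul_le_mul_right (hP.measure_le_urnWeight h0 x n y) _

theorem IsUrnChain.ae_tendsto_div_zero (hlam : lam ∈ Set.Ioo (0 : ℝ) 1) (hP : IsUrnChain lam P)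
    (x : ℤ) :
    ∀ᵐ ω ∂(P x), Tendsto (fun n : ℕ => (ω n : ℝ) / n) atTop (nhds 0) := by
  have h0 := hlam.1
  set C := ∑' y : ℤ, ENNReal.ofReal ((y : ℝ) ^ 2 * urnWeight lam y / urnWeight lam x) with hC
  have hCtop : C ≠ ⊤ :=
    ((summable_sq_mul_urnWeight hlam).div_const (urnWeight lam x)).tsum_ofReal_ne_top
  have hmeas : ∀ n : ℕ, Measurable fun ω : ℕ → ℤ => ENNReal.ofReal ((ω n : ℝ) ^ 2) := fun n =>
    (Measurable.of_discrete (f := fun y : ℤ => ENNReal.ofReal ((y : ℝ) ^ 2))).comp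
      (measurable_pi_apply n)
  have hfin : ∫⁻ ω, ∑' n : ℕ,
      ENNReal.ofReal (1 / (n : ℝ) ^ 2) * ENNReal.ofReal ((ω n : ℝ) ^ 2) ∂(P x) ≠ ⊤ := by
    rw [lintegral_tsum fun n => ((hmeas n).const_mul _).aemeasurable]
    refine ne_top_of_le_ne_top (ENNReal.mul_ne_top
      (Real.summable_one_div_nat_pow.mpr one_lt_two).tsum_ofReal_ne_top hCtop) ?_
    rw [← ENNReal.tsum_mul_right]
    refine ENNReal.tsum_le_tsum fun n => ?_
    rw [lintegral_const_mul _ (hmeas n)]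
    exact mul_le_mul_right (hP.lintegral_sq_le h0 x n) _
  filter_upwards [ae_lt_top (Measurable.tsum fun n => (hmeas n).const_mul _) hfin] with ω hω
  have ht := ENNReal.tendsto_atTop_zero_of_tsum_ne_top hω.ne
  have hsq : Tendsto (fun n : ℕ => ((ω n : ℝ) / n) ^ 2) atTop (nhds 0) := by
    have := (ENNReal.tendsto_toReal ENNReal.zero_ne_top).comp ht
    refine this.congr fun n => ?_
    have e : (0 : ℝ) ≤ 1 / (n : ℝ) ^ 2 := by positivity
    rw [Function.comp_apply, ← ENNReal.ofReal_mul e,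
      ENNReal.toReal_ofReal (mul_nonneg e (sq_nonneg _)), div_pow]
    ring
  have habs := hsq.sqrt
  simp only [Real.sqrt_sq_eq_abs, Real.sqrt_zero] at habs
  exact (tendsto_zero_iff_abs_tendsto_zero _).mpr habs

end Chain

theorem downCount_zero (ω : ℕ → ℤ) : downCount ω 0 = 0 := by simp [downCount]

theorem downCount_succ (ω : ℕ → ℤ) (n : ℕ) :
    downCount ω (n + 1) = downCount ω n + if ω (n + 1) = ω n - 1 then 1 else 0 := by
  unfold downCount
  rw [← Finset.insert_Icc_right_eq_Icc_add_one (by omega), Finset.filter_insert]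
  simp only [Nat.add_sub_cancel]
  split_ifs
  · rw [Finset.card_insert_of_notMem (by simp)]
  · rw [add_zero]

theorem downCount_le (ω : ℕ → ℤ) (n : ℕ) : downCount ω n ≤ n := by
  induction n with
  | zero => simp [downCount_zero]
  | succ n ih => rw [downCount_succ]; split_ifs <;> omega

theorem two_mul_downCount {ω : ℕ → ℤ}
    (hω : ∀ n, ω (n + 1) = ω n + 1 ∨ ω (n + 1) = ω n - 1) (n : ℕ) :
    2 * (downCount ω n : ℤ) = ω 0 + n - ω n := by
  induction n with
  | zero => simp [downCount_zero]
  | succ n ih =>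
    rw [downCount_succ]
    rcases hω n with h | h
    · rw [if_neg (by omega)]; push_cast; omega
    · rw [if_pos h]; push_cast; omega

theorem exists_downCount_eq {ω : ℕ → ℤ} (hω : Tendsto (downCount ω) atTop atTop) {j : ℕ}
    (hj : 1 ≤ j) : ∃ n, 1 ≤ n ∧ downCount ω n = j := by
  classical
  have hex : ∃ n, j ≤ downCount ω n := (hω.eventually_ge_atTop j).exists
  have hspec := Nat.find_spec hex
  have hmin := fun m => Nat.find_min hex (m := m)
  generalize Nat.find hex = n at hspec hmin
  cases n with
  | zero => rw [downCount_zero] at hspec; omega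
  | succ n =>
    refine ⟨n + 1, by omega, ?_⟩
    have := hmin n (Nat.lt_succ_self n)
    rw [downCount_succ] at hspec ⊢
    split_ifs at hspec ⊢ <;> omega

theorem tendsto_betaTime_div {ω : ℕ → ℤ}
    (hω : ∀ n, ω (n + 1) = ω n + 1 ∨ ω (n + 1) = ω n - 1)
    (hlim : Tendsto (fun n : ℕ => (ω n : ℝ) / n) atTop (nhds 0)) :
    Tendsto (fun j : ℕ => (betaTime ω j : ℝ) / (j : ℝ)) atTop (nhds 2) := by
  have hratio : Tendsto (fun n : ℕ => (downCount ω n : ℝ) / n) atTop (nhds (1 / 2)) := by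
    have h := (((tendsto_const_div_atTop_nhds_zero_nat (ω 0 : ℝ)).add_const 1).sub hlim).div_const 2
    rw [zero_add, sub_zero] at h
    refine h.congr' ?_
    filter_upwards [eventually_ge_atTop 1] with n hn
    have hn' : (n : ℝ) ≠ 0 := by positivity
    have e : 2 * (downCount ω n : ℝ) = ω 0 + n - ω n := by exact_mod_cast two_mul_downCount hω n
    field_simp
    linarith
  have hD : Tendsto (downCount ω) atTop atTop := by
    rw [← tendsto_natCast_atTop_iff (R := ℝ)]
    refine (hratio.pos_mul_atTop (by norm_num) tendsto_natCast_atTop_atTop).congr' ?_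
    filter_upwards [eventually_ge_atTop 1] with n hn
    have hn' : (n : ℝ) ≠ 0 := by positivity
    exact div_mul_cancel₀ _ hn'
  have hmem : ∀ j, 1 ≤ j → 1 ≤ betaTime ω j ∧ downCount ω (betaTime ω j) = j := fun j hj =>
    Nat.sInf_mem (exists_downCount_eq hD hj)
  have hbeta : Tendsto (betaTime ω) atTop atTop := by
    refine tendsto_atTop_mono' _ ?_ tendsto_id
    filter_upwards [eventually_ge_atTop 1] with j hj
    exact (hmem j hj).2.symm.le.trans (downCount_le _ _)
  have hinv := (hratio.comp hbeta).inv₀ (by norm_num)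
  rw [one_div, inv_inv] at hinv
  refine hinv.congr' ?_
  filter_upwards [eventually_ge_atTop 1] with j hj
  rw [Function.comp_apply, (hmem j hj).2, inv_div]

/-- Law of large numbers for the down-step times: `β_j / j → 2` almost surely. -/
theorem urn_beta_lln (lam : ℝ) (hlam : lam ∈ Set.Ioo (0 : ℝ) 1)
    (P : ℤ → Measure (ℕ → ℤ)) (hP : IsUrnChain lam P) :
    ∀ x : ℤ, ∀ᵐ ω ∂(P x),
      Tendsto (fun j : ℕ => (betaTime ω j : ℝ) / (j : ℝ)) atTop (nhds 2) := by
  intro x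
  filter_upwards [hP.ae_nearest_neighbor x, hP.ae_tendsto_div_zero hlam x] with ω h h'
  exact tendsto_betaTime_div h h'
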